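/- There exists a self-dual binary linear code C ⊆ F₂^{72} whose minimum nonzero Hamming weight is 12, which contains exactly 756 codewords of Hamming weight 12 and exactly 7488 codewords of Hamming weight 14 (the weight enumerator W_{72,1} with γ = 18 and β = 378). -/

import Mathlib

/-- A subspace `C` of `(ZMod 2)^ι` is self-dual if it equals its Euclidean dual. -/
def IsSelfDual {R : Type*} [CommRing R] {ι : Type*} [Fintype ι]
    (C : Submodule R (ι → R)) : Prop :=
  ∀ x, x ∈ C ↔ ∀ y ∈ C, ∑ i, x i * y i = 0

/-- The Hamming weight of a vector: the number of nonzero coordinates. -/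
def hamWt {ι : Type*} [Fintype ι] {R : Type*} [Zero R] [DecidableEq R] (v : ι → R) : ℕ :=
  (Finset.univ.filter fun i => v i ≠ 0).card

/-- The number whose binary digits, least significant first, are the given Booleans. -/
def pack : List Bool → ℕ
  | [] => 0
  | b :: l => Nat.bit b (pack l)

/-- The parity of the number of entries of a list at which `c` holds. -/
def parity {α : Type*} (c : α → Bool) (l : List α) : Bool :=
  l.foldr (fun x b => c x ^^ b) false

/-- The entry with index `k` is the pair of the number of `k`-element sublists of a list of Booleans
and the packed list of the parities of these sublists. -/
def parityTable (K : ℕ) (l : List Bool) : List (ℕ × ℕ) :=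
  l.foldr (fun c s => List.zipWith (fun q p =>
    (q.1 + p.1, q.2 ^^^ ((p.2 ^^^ (bif c then 2 ^ p.1 - 1 else 0)) <<< q.1))) s ((0, 0) :: s))
    ((1, 0) :: List.replicate K (0, 0))

/-- One layer of bitwise full adders: the sum bits together with the list of carries. -/
def compress : ℕ → List ℕ → ℕ × List ℕ
  | s, [] => (s, [])
  | s, [x] => (s ^^^ x, [s &&& x])
  | s, x :: y :: l =>
    ((compress (s ^^^ x ^^^ y) l).1,
      ((s &&& x) ^^^ ((s ^^^ x) &&& y)) :: (compress (s ^^^ x ^^^ y) l).2)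

/-- The `n` low-order bit planes of the bitwise count of a list of bit vectors. -/
def planes : ℕ → List ℕ → List ℕ
  | 0, _ => []
  | n + 1, xs => (compress 0 xs).1 :: planes n (compress 0 xs).2

/-- The positions at which the number given by the bit planes equals `m`. -/
def eqMask (full : ℕ) : List ℕ → ℕ → ℕ
  | [], _ => full
  | p :: ps, m => (bif m.testBit 0 then p else p ^^^ full) &&& eqMask full ps (m / 2)

/-- The number of ones among the `2 ^ n` low-order binary digits. -/
def popCount : ℕ → ℕ → ℕ
  | 0, x => x
  | n + 1, x => bif x == 0 then 0 else
    popCount n (x &&& (2 ^ (2 ^ n) - 1)) + popCount n (x >>> (2 ^ n))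

/-- The parity tables of the columns of a Boolean matrix. -/
def columnTables {n : ℕ} (K : ℕ) (a : Fin n → Fin n → Bool) : List (List (ℕ × ℕ)) :=
  (List.finRange n).map fun j => parityTable K ((List.finRange n).map fun i => a i j)

/-- The number of sums of `k` rows of weight `m`. -/
def wtCount {n : ℕ} (K b : ℕ) (a : Fin n → Fin n → Bool) (k m : ℕ) : ℕ :=
  popCount b (eqMask (2 ^ n.choose k - 1)
    (planes 6 ((columnTables K a).map fun s => (s.getD k (0, 0)).2)) m)

/-- The rows of the right half `A` of the generator matrix `(1 | A)`, as binary numbers. -/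
def codeRows : List ℕ :=
  [64283703713, 27959240750, 47648491139, 48326787253, 27934359914, 47766508555,
    48562890149, 59870744614, 28211080703, 1403328077, 2806656154, 52583240839,
    61765271505, 33005544654, 39787388739, 68579128117, 19376782598, 19147306943,
    26257528539, 5545189381, 11090378762, 13807752907, 1930509129, 3861018258,
    54708674711, 66116802545, 24226985102, 26721133743, 44769632129, 67465536622,
    9028240751, 9283181569, 65482974062, 13128764271, 49085340524, 58902408628]

/-- The right half `A` of the generator matrix `(1 | A)`. -/
def codeMat (i j : Fin 36) : Bool := (codeRows.getD i 0).testBit j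

/-- The number of words of weight `t` in the code generated by `(1 | A)`, for an orthogonal
matrix `A`: those with at most half of their weight on the left are sums of few rows of `A`,
the others are determined by their right half through `Aᵀ`. -/
def codeCount {n : ℕ} (K b : ℕ) (a : Fin n → Fin n → Bool) (t : ℕ) : ℕ :=
  ((List.range (t / 2 + 1)).map fun k => wtCount K b a k (t - k)).sum +
    ((List.range (t - t / 2)).map fun k => wtCount K b (fun i j => a j i) k (t - k)).sum

theorem testBit_pack (l : List Bool) (i : ℕ) : (pack l).testBit i = l.getD i false := by
  induction l generalizing i with
  | nil => simp [pack]
  | cons b l ih =>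
    cases i with
    | zero => simp [pack]
    | succ i => simp [pack, Nat.testBit_bit_succ, ih]

theorem pack_append (l₁ l₂ : List Bool) :
    pack (l₁ ++ l₂) = pack l₁ ^^^ (pack l₂ <<< l₁.length) := by
  refine Nat.eq_of_testBit_eq fun i => ?_
  simp only [Nat.testBit_xor, Nat.testBit_shiftLeft, testBit_pack]
  rcases lt_or_ge i l₁.length with h | h
  · rw [List.getD_append _ _ _ _ h]
    simp [h, Nat.not_le.mpr h]
  · rw [List.getD_append_right _ _ _ _ h, List.getD_eq_default _ _ h]
    simp [h]

section Lanes

variable {β : Type*} (S : List β)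

theorem eq_pack_map_of_testBit (op : Bool → Bool → Bool) (h : op false false = false)
    (f g : β → Bool) (x : ℕ)
    (hx : ∀ i, x.testBit i = op ((pack (S.map f)).testBit i) ((pack (S.map g)).testBit i)) :
    x = pack (S.map fun s => op (f s) (g s)) := by
  refine Nat.eq_of_testBit_eq fun i => ?_
  rw [hx]
  simp only [testBit_pack, List.getD_eq_getElem?_getD, List.getElem?_map]
  cases S[i]? <;> simp [h]

theorem pack_xor_pack (f g : β → Bool) :
    pack (S.map f) ^^^ pack (S.map g) = pack (S.map fun s => f s ^^ g s) :=
  eq_pack_map_of_testBit S _ rfl f g _ fun _ => Nat.testBit_xor ..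

theorem pack_and_pack (f g : β → Bool) :
    pack (S.map f) &&& pack (S.map g) = pack (S.map fun s => f s && g s) :=
  eq_pack_map_of_testBit S _ rfl f g _ fun _ => Nat.testBit_and ..

theorem two_pow_sub_one_eq_pack : 2 ^ S.length - 1 = pack (S.map fun _ => true) := by
  refine Nat.eq_of_testBit_eq fun i => ?_
  simp only [testBit_pack, Nat.testBit_two_pow_sub_one, List.getD_eq_getElem?_getD,
    List.getElem?_map]
  by_cases h : i < S.length <;> simp [h]

theorem zero_eq_pack : 0 = pack (S.map fun _ => false) := by
  refine Nat.eq_of_testBit_eq fun i => ?_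
  simp only [testBit_pack, List.getD_eq_getElem?_getD, List.getElem?_map]
  cases S[i]? <;> simp

theorem compress_spec : ∀ (s : β → Bool) (F : List (β → Bool)),
    ∃ (g : β → Bool) (G : List (β → Bool)),
    compress (pack (S.map s)) (F.map fun f => pack (S.map f)) =
      (pack (S.map g), G.map fun f => pack (S.map f)) ∧
    ∀ b, (s b).toNat + (F.map fun f => (f b).toNat).sum =
      (g b).toNat + 2 * (G.map fun f => (f b).toNat).sum
  | s, [] => ⟨s, [], by simp [compress]⟩
  | s, [f] => by
    refine ⟨fun b => s b ^^ f b, [fun b => s b && f b], ?_, fun b => ?_⟩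
    · simp [compress, pack_xor_pack, pack_and_pack]
    · cases hs : s b <;> cases hf : f b <;> simp [hs, hf]
  | s, e :: f :: F => by
    obtain ⟨g, G, h, hG⟩ := compress_spec (fun b => s b ^^ e b ^^ f b) F
    refine ⟨g, (fun b => (s b && e b) ^^ ((s b ^^ e b) && f b)) :: G, ?_, fun b => ?_⟩
    · simp only [compress, List.map_cons, pack_xor_pack, pack_and_pack, h]
    · have := hG b
      simp only [List.map_cons, List.sum_cons]
      cases hs : s b <;> cases he : e b <;> cases hf : f b <;> simp [hs, he, hf] at this ⊢ <;> omega

/-- The number with the given binary digits, least significant first. -/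
def planeValue (G : List (β → Bool)) (b : β) : ℕ :=
  G.foldr (fun g v => (g b).toNat + 2 * v) 0

theorem planes_spec (n : ℕ) (F : List (β → Bool)) : ∃ G : List (β → Bool), G.length = n ∧
    planes n (F.map fun f => pack (S.map f)) = G.map (fun f => pack (S.map f)) ∧
    ∀ b, planeValue G b = (F.map fun f => (f b).toNat).sum % 2 ^ n := by
  induction n generalizing F with
  | zero => exact ⟨[], by simp [planes, planeValue, Nat.mod_one]⟩
  | succ n ih =>
    obtain ⟨g, G, h, hG⟩ := compress_spec S (fun _ => false) F
    obtain ⟨H, rfl, hH, hv⟩ := ih G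
    rw [← zero_eq_pack] at h
    refine ⟨g :: H, rfl, by simp [planes, h, hH], fun b => ?_⟩
    have h₁ := hG b
    have h₂ := hv b
    have h₃ : (g b).toNat < 2 := Bool.toNat_lt _
    simp only [planeValue, List.foldr_cons] at h₂ ⊢
    simp only [Bool.toNat_false, zero_add] at h₁
    rw [h₂, h₁, pow_succ', Nat.mod_mul,
      show ((g b).toNat + 2 * (G.map fun f => (f b).toNat).sum) / 2 =
        (G.map fun f => (f b).toNat).sum by omega]
    omega

theorem eqMask_spec (G : List (β → Bool)) (m : ℕ) (hm : m < 2 ^ G.length) :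
    eqMask (2 ^ S.length - 1) (G.map fun f => pack (S.map f)) m =
      pack (S.map fun b => decide (planeValue G b = m)) := by
  induction G generalizing m with
  | nil =>
    obtain rfl : m = 0 := by simpa using hm
    simp [eqMask, planeValue, two_pow_sub_one_eq_pack]
  | cons g G ih =>
    have h₁ : (bif m.testBit 0 then pack (S.map g) else pack (S.map g) ^^^ (2 ^ S.length - 1)) =
        pack (S.map fun b => g b == m.testBit 0) := by
      rw [two_pow_sub_one_eq_pack, pack_xor_pack]
      cases m.testBit 0 <;> simp
    rw [List.map_cons, eqMask, h₁, ih _ (by rw [List.length_cons, pow_succ] at hm; omega),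
      pack_and_pack]
    have h₂ (c : Bool) (v : ℕ) :
        (c == m.testBit 0 && decide (v = m / 2)) = decide (c.toNat + 2 * v = m) := by
      rw [Bool.eq_iff_iff, Nat.testBit_zero]
      simp only [Bool.and_eq_true, beq_iff_eq, decide_eq_true_eq]
      cases c <;> simp <;> omega
    exact congrArg pack (List.map_congr_left fun b _ => h₂ _ _)

end Lanes

theorem popCount_pack (n : ℕ) (l : List Bool) (hl : l.length ≤ 2 ^ n) :
    popCount n (pack l) = l.count true := by
  induction n generalizing l with
  | zero =>
    match l, hl with
    | [], _ => rfl
    | [b], _ => cases b <;> rfl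
  | succ n ih =>
    rw [popCount]
    have h₁ : pack l &&& (2 ^ 2 ^ n - 1) = pack (l.take (2 ^ n)) := by
      refine Nat.eq_of_testBit_eq fun i => ?_
      simp only [Nat.testBit_and, testBit_pack, Nat.testBit_two_pow_sub_one,
        List.getD_eq_getElem?_getD, List.getElem?_take]
      by_cases h : i < 2 ^ n <;> simp [h]
    have h₂ : pack l >>> 2 ^ n = pack (l.drop (2 ^ n)) := by
      refine Nat.eq_of_testBit_eq fun i => ?_
      simp [testBit_pack, List.getD_eq_getElem?_getD, Nat.testBit_shiftRight]
    rw [h₁, h₂, ih _ (by simp), ih _ (by rw [List.length_drop]; rw [pow_succ] at hl; omega),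
      ← List.count_append, List.take_append_drop]
    cases h : pack l == 0
    · rfl
    · symm
      rw [cond_true, List.count_eq_zero]
      intro hmem
      obtain ⟨i, hi, hb⟩ := List.mem_iff_getElem.mp hmem
      have := testBit_pack l i
      simp_all

theorem parityTable_map {α : Type*} (K : ℕ) (c : α → Bool) (l : List α) :
    parityTable K (l.map c) = (List.range (K + 1)).map fun k =>
      ((l.sublistsLen k).length, pack ((l.sublistsLen k).map (parity c))) := by
  induction l with
  | nil =>
    refine List.ext_getElem (by simp [parityTable]) fun i h₁ h₂ => ?_
    cases i <;> simp [parityTable, parity, pack]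
  | cons x l ih =>
    rw [List.map_cons, parityTable, List.foldr_cons, ← parityTable, ih]
    refine List.ext_getElem (by simp) fun i h₁ h₂ => ?_
    cases i with
    | zero => simp [parity]
    | succ k =>
      have h₃ : (l.sublistsLen k).map (parity c ∘ List.cons x) =
          (l.sublistsLen k).map fun s => c x ^^ parity c s := rfl
      have h₄ : pack ((l.sublistsLen k).map (parity c)) ^^^
          (bif c x then 2 ^ (l.sublistsLen k).length - 1 else 0) =
          pack ((l.sublistsLen k).map fun s => c x ^^ parity c s) := by
        cases c x
        · simp
        · rw [cond_true, two_pow_sub_one_eq_pack, pack_xor_pack]; simp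
      simp only [List.getElem_zipWith, List.getElem_map, List.getElem_range, List.getElem_cons_succ,
        List.sublistsLen_succ_cons, List.length_append, List.length_map, List.map_append,
        List.map_map, pack_append, h₃, h₄]

theorem wtCount_eq_countP {n K b : ℕ} (a : Fin n → Fin n → Bool) {k m : ℕ} (hn : n < 64)
    (hk : k ≤ K) (hm : m < 64) (hb : n.choose k ≤ 2 ^ b) :
    wtCount K b a k m = ((List.finRange n).sublistsLen k).countP fun s =>
      decide (((List.finRange n).map fun j => (parity (a · j) s).toNat).sum = m) := by
  have hlen : ((List.finRange n).sublistsLen k).length = n.choose k := by simp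
  have hcol : (columnTables K a).map (fun s => (s.getD k (0, 0)).2) =
      ((List.finRange n).map fun j => parity (a · j)).map fun f =>
        pack (((List.finRange n).sublistsLen k).map f) := by
    simp only [columnTables, List.map_map]
    congr 1
    funext j
    simp [parityTable_map, List.getD_eq_getElem?_getD, Nat.lt_succ_of_le hk]
  obtain ⟨G, hG, hp, hv⟩ := planes_spec ((List.finRange n).sublistsLen k) 6
    ((List.finRange n).map fun j => parity (a · j))
  rw [wtCount, hcol, hp, ← hlen, eqMask_spec _ _ _ (by rw [hG]; exact hm),
    popCount_pack _ _ (by rw [List.length_map, hlen]; exact hb), List.count_eq_countP,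
    List.countP_map]
  refine List.countP_congr fun s _ => ?_
  have hle : ((List.finRange n).map fun j => (parity (a · j) s).toNat).sum < 2 ^ 6 := by
    refine lt_of_le_of_lt (List.sum_le_card_nsmul _ 1 ?_) (by simpa using hn)
    simp only [List.mem_map, forall_exists_index, and_imp]
    rintro _ j _ rfl
    exact Bool.toNat_le _
  simp only [Function.comp_def, beq_true, hv, List.map_map, Nat.mod_eq_of_lt hle]

theorem sum_map_ite_eq_parity {α : Type*} (c : α → Bool) (l : List α) :
    (l.map fun x => if c x then (1 : ZMod 2) else 0).sum = if parity c l then 1 else 0 := by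
  induction l with
  | nil => rfl
  | cons x l ih =>
    rw [List.map_cons, List.sum_cons, ih]
    change _ = if (c x ^^ parity c l) then (1 : ZMod 2) else 0
    cases c x <;> cases parity c l <;> decide

/-- The matrix over `ZMod 2` with the given pattern of ones. -/
def boolMatrix {n : ℕ} (a : Fin n → Fin n → Bool) : Matrix (Fin n) (Fin n) (ZMod 2) :=
  Matrix.of fun i j => if a i j then 1 else 0

section Code

open Matrix Finset

theorem hamWt_eq_sum {ι R : Type*} [Fintype ι] [Zero R] [DecidableEq R] (v : ι → R) :
    hamWt v = ∑ i, if v i ≠ 0 then (1 : ℕ) else 0 :=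
  Finset.card_filter (fun i => v i ≠ 0) univ

theorem vecMul_eq_sum_support {n : ℕ} (A : Matrix (Fin n) (Fin n) (ZMod 2)) (u : Fin n → ZMod 2) :
    u ᵥ* A = fun j => ∑ i with u i ≠ 0, A i j := by
  funext j
  rw [Finset.sum_filter]
  have h : ∀ x y : ZMod 2, x * y = if x ≠ 0 then y else 0 := by decide
  simp only [vecMul, dotProduct, h]

theorem wtCount_eq_card {n K b : ℕ} (a : Fin n → Fin n → Bool) {k m : ℕ} (hn : n < 64)
    (hk : k ≤ K) (hm : m < 64) (hb : n.choose k ≤ 2 ^ b) :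
    wtCount K b a k m = #{u : Fin n → ZMod 2 | hamWt u = k ∧ hamWt (u ᵥ* boolMatrix a) = m} := by
  let Q (M : Multiset (Fin n)) : Prop := hamWt (fun j => (M.map fun i => boolMatrix a i j).sum) = m
  have h₁ : wtCount K b a k m = ((List.finRange n).sublistsLen k).countP fun s : List (Fin n) =>
      decide (Q (s : Multiset (Fin n))) := by
    rw [wtCount_eq_countP a hn hk hm hb]
    refine List.countP_congr fun s _ => ?_
    have h : ((List.finRange n).map fun j => (parity (a · j) s).toNat).sum =
        hamWt (fun j => ((s : Multiset (Fin n)).map fun i => boolMatrix a i j).sum) := by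
      rw [hamWt_eq_sum, Fin.sum_univ_def]
      congr 2
      funext j
      simp only [boolMatrix, of_apply, Multiset.map_coe, Multiset.sum_coe, sum_map_ite_eq_parity]
      cases parity (a · j) s <;> simp
    simp only [h, Q]
  have h₂ : ((List.finRange n).sublistsLen k).countP
      (fun s : List (Fin n) => decide (Q (s : Multiset (Fin n)))) =
      #{T ∈ powersetCard k (univ : Finset (Fin n)) | Q T.val} := by
    have h : ((powersetCard k (univ : Finset (Fin n))).val.map Finset.val) =
        ((List.finRange n).sublistsLen k).map fun s : List (Fin n) => (s : Multiset (Fin n)) := by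
      rw [Finset.map_val_val_powersetCard, ← Multiset.powersetCard_coe]
      rfl
    refine Eq.trans ?_ (Multiset.countP_map Finset.val (powersetCard k univ).val Q)
    rw [h, Multiset.coe_countP, List.countP_map]
    rfl
  have h₃ (u : Fin n → ZMod 2) : hamWt (u ᵥ* boolMatrix a) = m ↔
      Q (univ.filter fun i => u i ≠ 0).val := by
    rw [vecMul_eq_sum_support]
    rfl
  have h₄ (T : Finset (Fin n)) :
      (univ.filter fun i => (if i ∈ T then (1 : ZMod 2) else 0) ≠ 0) = T := by
    ext i; simp
  rw [h₁, h₂]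
  refine Finset.card_nbij' (fun T i => if i ∈ T then 1 else 0) (fun u => univ.filter (u · ≠ 0))
    (fun T hT => ?_) (fun u hu => ?_) (fun T _ => h₄ T) (fun u _ => ?_)
  · simp only [coe_filter, mem_powersetCard_univ, Set.mem_ofPred_eq, mem_univ, true_and] at hT ⊢
    rw [h₃, hamWt, h₄]
    exact hT
  · simp only [coe_filter, mem_powersetCard_univ, Set.mem_ofPred_eq, mem_univ, true_and] at hu ⊢
    exact ⟨hu.1, (h₃ u).1 hu.2⟩
  · funext i
    have : ∀ x : ZMod 2, (if x ≠ 0 then 1 else 0) = x := by decide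
    simpa using this (u i)

/-- The code of length `2 * n` with generator matrix `(1 | A)`. -/
def graphCode {n : ℕ} (A : Matrix (Fin n) (Fin n) (ZMod 2)) :
    Submodule (ZMod 2) (Fin (n + n) → ZMod 2) where
  carrier := {v | (fun j => v (Fin.natAdd n j)) = (fun i => v (Fin.castAdd n i)) ᵥ* A}
  add_mem' {v w} hv hw := by
    simp only [Set.mem_ofPred_eq] at hv hw ⊢
    have := congrArg₂ (· + ·) hv hw
    simp only [← add_vecMul] at this
    exact this
  zero_mem' := (zero_vecMul A).symm
  smul_mem' c v hv := by
    simp only [Set.mem_ofPred_eq] at hv ⊢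
    have := congrArg (c • ·) hv
    simp only [← smul_vecMul] at this
    exact this

section GraphCode

variable {n : ℕ} {A : Matrix (Fin n) (Fin n) (ZMod 2)}

theorem mem_graphCode {v : Fin (n + n) → ZMod 2} : v ∈ graphCode A ↔
    (fun j => v (Fin.natAdd n j)) = (fun i => v (Fin.castAdd n i)) ᵥ* A :=
  Iff.rfl

theorem append_mem_graphCode (u : Fin n → ZMod 2) : Fin.append u (u ᵥ* A) ∈ graphCode A := by
  simp only [mem_graphCode, Fin.append_left, Fin.append_right]

theorem isSelfDual_graphCode (hA : A * Aᵀ = 1) : IsSelfDual (graphCode A) := by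
  have hA' : Aᵀ * A = 1 := mul_eq_one_comm.mp hA
  intro x
  constructor
  · intro hx y hy
    rw [mem_graphCode] at hx hy
    have h := Fin.sum_univ_add fun i => x i * y i
    change _ = (fun i => x (Fin.castAdd n i)) ⬝ᵥ (fun i => y (Fin.castAdd n i)) +
      (fun i => x (Fin.natAdd n i)) ⬝ᵥ (fun i => y (Fin.natAdd n i)) at h
    rw [h, hx, hy, ← dotProduct_mulVec, ← mulVec_transpose, mulVec_mulVec, hA, one_mulVec,
      CharTwo.add_self_eq_zero]
  · intro h
    have h' : A *ᵥ (fun j => x (Fin.natAdd n j)) = fun i => x (Fin.castAdd n i) := by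
      refine dotProduct_eq _ _ fun u => ?_
      have h₁ := h _ (append_mem_graphCode u)
      rw [Fin.sum_univ_add] at h₁
      simp only [Fin.append_left, Fin.append_right] at h₁
      change (fun i => x (Fin.castAdd n i)) ⬝ᵥ u + (fun i => x (Fin.natAdd n i)) ⬝ᵥ (u ᵥ* A) = 0
        at h₁
      rw [dotProduct_comm _ (u ᵥ* A), ← dotProduct_mulVec, dotProduct_comm u] at h₁
      exact (CharTwo.add_eq_zero.mp h₁).symm
    rw [mem_graphCode, ← h', ← mulVec_transpose, mulVec_mulVec, hA', one_mulVec]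

theorem hamWt_append (u w : Fin n → ZMod 2) : hamWt (Fin.append u w) = hamWt u + hamWt w := by
  simp only [hamWt_eq_sum, Fin.sum_univ_add, Fin.append_left, Fin.append_right]

theorem natCard_graphCode (t : ℕ) :
    Nat.card {v : Fin (n + n) → ZMod 2 // v ∈ graphCode A ∧ hamWt v = t} =
      #{u : Fin n → ZMod 2 | hamWt u + hamWt (u ᵥ* A) = t} := by
  have hinj : Function.Injective fun u : Fin n → ZMod 2 => Fin.append u (u ᵥ* A) := by
    intro u u' h
    funext i
    simpa using congrFun h (Fin.castAdd n i)
  rw [← Finset.card_image_of_injective _ hinj]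
  refine Nat.subtype_card _ fun v => ?_
  simp only [mem_image, mem_filter, mem_univ, true_and]
  constructor
  · rintro ⟨u, hu, rfl⟩
    exact ⟨append_mem_graphCode u, by rw [hamWt_append, hu]⟩
  · rintro ⟨hv, hw⟩
    have hv' : Fin.append (fun i => v (Fin.castAdd n i))
        ((fun i => v (Fin.castAdd n i)) ᵥ* A) = v := by
      rw [← mem_graphCode.mp hv, Fin.append_castAdd_natAdd]
    exact ⟨_, by rw [← hamWt_append, hv', hw], hv'⟩

end GraphCode

theorem card_filter_add_eq_and_lt {α : Type*} [Fintype α] (f g : α → ℕ) {s t : ℕ}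
    (hs : s ≤ t + 1) :
    #{u | f u + g u = t ∧ f u < s} =
      ((List.range s).map fun k => #{u | f u = k ∧ g u = t - k}).sum := by
  rw [Finset.card_eq_sum_card_fiberwise (f := f) (t := Finset.range s)
    (fun u hu => by simpa using (Finset.mem_filter.mp hu).2.2)]
  change ∑ k ∈ _, _ = ∑ k ∈ Finset.range s, _
  refine Finset.sum_congr rfl fun k hk => congrArg Finset.card ?_
  ext u
  simp only [mem_filter, mem_univ, true_and, Finset.mem_range] at hk ⊢
  omega

theorem natCard_graphCode_eq_codeCount {n K b : ℕ} {a : Fin n → Fin n → Bool}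
    (ha : boolMatrix a * (boolMatrix a)ᵀ = 1) (hn : n < 64) (hb : ∀ k ≤ K, n.choose k ≤ 2 ^ b)
    {t : ℕ} (ht : t < 64) (hK : t / 2 ≤ K) :
    Nat.card {v : Fin (n + n) → ZMod 2 // v ∈ graphCode (boolMatrix a) ∧ hamWt v = t} =
      codeCount K b a t := by
  have ha' : (boolMatrix a)ᵀ * boolMatrix a = 1 := mul_eq_one_comm.mp ha
  have hsum (c : Fin n → Fin n → Bool) {s : ℕ} (hs : s ≤ t + 1) (hsK : s ≤ K + 1) :
      ((List.range s).map fun k => wtCount K b c k (t - k)).sum =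
        #{u : Fin n → ZMod 2 | hamWt u + hamWt (u ᵥ* boolMatrix c) = t ∧ hamWt u < s} := by
    rw [card_filter_add_eq_and_lt _ _ hs]
    congr 1
    refine List.map_congr_left fun k hk => ?_
    have := List.mem_range.mp hk
    exact wtCount_eq_card c hn (by omega) (by omega) (hb k (by omega))
  have hT : boolMatrix (fun i j => a j i) = (boolMatrix a)ᵀ := rfl
  rw [natCard_graphCode, codeCount, hsum _ (by omega) (by omega), hsum _ (by omega) (by omega), hT,
    ← Finset.card_filter_add_card_filter_not (fun u => hamWt u < t / 2 + 1), Finset.filter_filter,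
    Finset.filter_filter]
  congr 1
  have h₁ (u : Fin n → ZMod 2) : u ᵥ* boolMatrix a ᵥ* (boolMatrix a)ᵀ = u := by
    rw [vecMul_vecMul, ha, vecMul_one]
  have h₂ (u : Fin n → ZMod 2) : u ᵥ* (boolMatrix a)ᵀ ᵥ* boolMatrix a = u := by
    rw [vecMul_vecMul, ha', vecMul_one]
  refine Finset.card_nbij' (· ᵥ* boolMatrix a) (· ᵥ* (boolMatrix a)ᵀ) (fun u hu => ?_)
    (fun u hu => ?_) (fun u _ => h₁ u) (fun u _ => h₂ u)
  · simp only [coe_filter, mem_univ, true_and, Set.mem_ofPred_eq, h₁] at hu ⊢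
    omega
  · simp only [coe_filter, mem_univ, true_and, Set.mem_ofPred_eq, h₂] at hu ⊢
    omega

theorem parity_codeMat_and : ∀ i j : Fin 36,
    parity (fun k => codeMat i k && codeMat j k) (List.finRange 36) = decide (i = j) := by
  decide +kernel

theorem boolMatrix_codeMat_mul_transpose : boolMatrix codeMat * (boolMatrix codeMat)ᵀ = 1 := by
  ext i j
  rw [mul_apply, Fin.sum_univ_def, one_apply]
  have h : (fun k => boolMatrix codeMat i k * (boolMatrix codeMat)ᵀ k j) =
      fun k => if codeMat i k && codeMat j k then (1 : ZMod 2) else 0 := by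
    funext k
    simp only [boolMatrix, of_apply, transpose_apply]
    cases codeMat i k <;> cases codeMat j k <;> rfl
  rw [h, sum_map_ite_eq_parity, parity_codeMat_and]
  simp

theorem codeCount_codeMat : (∀ t ∈ List.range 12, t ≠ 0 → codeCount 7 23 codeMat t = 0) ∧
    codeCount 7 23 codeMat 12 = 756 ∧ codeCount 7 23 codeMat 14 = 7488 := by
  decide +kernel

end Code

/-- There is a self-dual binary linear code of length 72 with minimum nonzero Hamming
weight 12, having exactly 756 codewords of weight 12 and exactly 7488 codewords of
weight 14 (weight enumerator `W_{72,1}` with γ = 18 and β = 378). -/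
theorem exists_selfDual_code_72_gamma_18_beta_378 :
    ∃ C : Submodule (ZMod 2) (Fin 72 → ZMod 2),
      IsSelfDual C ∧
      IsLeast {k | ∃ v ∈ C, v ≠ 0 ∧ hamWt v = k} 12 ∧
      Nat.card {v : Fin 72 → ZMod 2 // v ∈ C ∧ hamWt v = 12} = 756 ∧
      Nat.card {v : Fin 72 → ZMod 2 // v ∈ C ∧ hamWt v = 14} = 7488 := by
  obtain ⟨h₀, h₁₂, h₁₄⟩ := codeCount_codeMat
  have hcard {t : ℕ} (ht : t < 16) :
      Nat.card {v : Fin 72 → ZMod 2 // v ∈ graphCode (boolMatrix codeMat) ∧ hamWt v = t} =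
        codeCount 7 23 codeMat t :=
    natCard_graphCode_eq_codeCount boolMatrix_codeMat_mul_transpose (by norm_num) (by decide)
      (by omega) (by omega)
  refine ⟨graphCode (boolMatrix codeMat), isSelfDual_graphCode boolMatrix_codeMat_mul_transpose,
    ⟨?_, ?_⟩, (hcard (by norm_num)).trans h₁₂, (hcard (by norm_num)).trans h₁₄⟩
  · have h := (hcard (t := 12) (by norm_num)).trans h₁₂
    obtain ⟨⟨v, hv, hw⟩⟩ := (Nat.card_pos_iff.mp (by rw [h]; norm_num)).1
    exact ⟨v, hv, by rintro rfl; simp [hamWt] at hw, hw⟩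
  · rintro k ⟨v, hv, hv₀, hw⟩
    by_contra! hk
    have hk₀ : k ≠ 0 := by
      rintro rfl
      refine hv₀ (funext fun i => ?_)
      simpa using Finset.filter_eq_empty_iff.mp (Finset.card_eq_zero.mp hw) (Finset.mem_univ i)
    have h := (hcard (t := k) (by omega)).trans (h₀ k (List.mem_range.mpr hk) hk₀)
    rw [Nat.card_eq_zero] at h
    rcases h with h | h
    · exact h.elim ⟨v, hv, hw⟩
    · exact h.not_finite inferInstance
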